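/- Let Σ_A be a one-sided countable topological Markov shift, φ : Σ_A → ℝ a measurable potential, and ν a σ-finite Borel measure with ν(π_n^{−1}{s}) < ∞ for every n ≥ 0 and s ∈ ℕ, where π_n(x) := x_n. Then ν is a φ-DLR measure if and only if for every n ∈ ℕ and every pair of cylinders [a̲] = [a_0,…,a_{n−1}] and [b̲] = [b_0,…,b_{n−1}] of length n with a_{n−1} = b_{n−1} and ν([a̲]) > 0, the map v_{a̲,b̲} : [a̲] → [b̲] defined by v_{a̲,b̲}(a̲ x_n x_{n+1} …) := b̲ x_n x_{n+1} … satisfies ν(v_{a̲,b̲}(E)) = ∫_E e^{φ_n(b̲ x_n^∞) − φ_n(a̲ x_n^∞)} dν(x) for every measurable E ⊆ [a̲], where x_n^∞ := (x_n, x_{n+1}, …). -/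

import Mathlib

open MeasureTheory Filter Topology ENNReal

namespace CMS

/-- A sequence is admissible for the transition matrix `A`. -/
def IsAdm (A : ℕ → ℕ → Bool) (u : ℕ → ℕ) : Prop := ∀ i, A (u i) (u (i + 1)) = true

/-- The one-sided countable topological Markov shift. -/
abbrev Space (A : ℕ → ℕ → Bool) := {u : ℕ → ℕ // IsAdm A u}

/-- The transition matrix has no row and no column identically zero. -/
def NoDegenerate (A : ℕ → ℕ → Bool) : Prop :=
  (∀ i, ∃ j, A i j = true) ∧ (∀ j, ∃ i, A i j = true)

/-- The shift map. -/
def shift {A : ℕ → ℕ → Bool} (x : Space A) : Space A :=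
  ⟨fun i => x.1 (i + 1), fun i => x.2 (i + 1)⟩

/-- Birkhoff (ergodic) sum `φ_n`. -/
noncomputable def birkhoff {A : ℕ → ℕ → Bool} (φ : Space A → ℝ) (n : ℕ) (x : Space A) : ℝ :=
  ∑ i ∈ Finset.range n, φ (shift^[i] x)

/-- The cylinder set determined by a word. -/
def cyl (A : ℕ → ℕ → Bool) (w : List ℕ) : Set (Space A) :=
  {x | ∀ i : Fin w.length, x.1 i = w.get i}

/-- Concatenation of a finite word with a sequence. -/
def concatSeq (w : List ℕ) (u : ℕ → ℕ) : ℕ → ℕ :=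
  fun i => if h : i < w.length then w.get ⟨i, h⟩ else u (i - w.length)

/-- Prepending a single symbol to a sequence. -/
def prependSeq (a : ℕ) (u : ℕ → ℕ) : ℕ → ℕ := fun i => Nat.casesOn i a u

/-- The set of points to which the symbol `a` may be prepended. -/
def admits (A : ℕ → ℕ → Bool) (a : ℕ) : Set (Space A) := {x | A a (x.1 0) = true}

/-- Prepending a symbol to a point of the shift space (identity if not admissible). -/
noncomputable def prep (A : ℕ → ℕ → Bool) (a : ℕ) (x : Space A) : Space A :=
  if h : A a (x.1 0) = true then
    ⟨prependSeq a x.1, by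
      intro i
      cases i with
      | zero => exact h
      | succ j => exact x.2 j⟩
  else x

/-- The measure `ν ⊚ σ`, `ν⊚σ(E) = Σ_a ν(σ(E ∩ [a]))`. -/
noncomputable def circ (A : ℕ → ℕ → Bool) (ν : Measure (Space A)) : Measure (Space A) :=
  Measure.sum fun a : ℕ => (ν.restrict (admits A a)).map (prep A a)

/-- `ν` is `(φ, l)`-conformal: `dν/d(ν⊚σ) = l⁻¹ e^φ`. -/
def Conformal (A : ℕ → ℕ → Bool) (φ : Space A → ℝ) (l : ℝ) (ν : Measure (Space A)) : Prop :=
  ∀ E : Set (Space A), MeasurableSet E →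
    ν E = ∫⁻ x in E, ENNReal.ofReal (l⁻¹ * Real.exp (φ x)) ∂(circ A ν)

/-- The Ruelle transfer operator. -/
noncomputable def ruelle (A : ℕ → ℕ → Bool) (φ f : Space A → ℝ) (x : Space A) : ℝ :=
  ∑' a : ℕ, if A a (x.1 0) = true then Real.exp (φ (prep A a x)) * f (prep A a x) else 0

/-- The Ruelle operator applied to the constant function 1, valued in `ℝ≥0∞`. -/
noncomputable def ruelleOne (A : ℕ → ℕ → Bool) (φ : Space A → ℝ) (x : Space A) : ℝ≥0∞ :=
  ∑' a : ℕ, if A a (x.1 0) = true then ENNReal.ofReal (Real.exp (φ (prep A a x))) else 0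

/-- `L*_φ ν = l ν` : the dual eigenmeasure equation. -/
def DualEigen (A : ℕ → ℕ → Bool) (φ : Space A → ℝ) (l : ℝ) (ν : Measure (Space A)) : Prop :=
  ∀ f : Space A → ℝ, Integrable f ν →
    ∫ x, ruelle A φ f x ∂ν = l * ∫ x, f x ∂ν

/-- The sub-σ-algebra `σ^{-n} 𝓑`. -/
def shiftSigma (A : ℕ → ℕ → Bool) (n : ℕ) : MeasurableSpace (Space A) :=
  MeasurableSpace.comap (shift^[n]) inferInstance

/-- A sub-σ-algebra `m` is compatible with `ν`: the restriction of `ν` to `m` is σ-finite. -/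
def Compatible (A : ℕ → ℕ → Bool) (ν : Measure (Space A))
    (m : MeasurableSpace (Space A)) : Prop :=
  ∃ s : ℕ → Set (Space A), (∀ k, MeasurableSet[m] (s k)) ∧ (∀ k, ν (s k) ≠ ⊤) ∧
    (⋃ k, s k) = Set.univ

open Classical in
/-- Numerator of the DLR kernel: `e^{φ_n(w σ^n x)} 1{w σ^n x ∈ Σ_A}`. -/
noncomputable def dlrNum (A : ℕ → ℕ → Bool) (φ : Space A → ℝ) (w : List ℕ)
    (x : Space A) : ℝ :=
  if h : IsAdm A (concatSeq w ((shift^[w.length] x).1)) then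
    Real.exp (birkhoff φ w.length (⟨concatSeq w ((shift^[w.length] x).1), h⟩ : Space A))
  else 0

/-- Denominator of the DLR kernel: `Σ_{y : σ^n y = σ^n x} e^{φ_n(y)}`. -/
noncomputable def dlrDen (A : ℕ → ℕ → Bool) (φ : Space A → ℝ) (n : ℕ) (x : Space A) : ℝ :=
  ∑' y : {y : Space A // shift^[n] y = shift^[n] x}, Real.exp (birkhoff φ n y.1)

/-- `ν` is a `φ`-DLR measure. -/
def IsDLR (A : ℕ → ℕ → Bool) (φ : Space A → ℝ) (ν : Measure (Space A)) : Prop :=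
  ∀ n : ℕ, 1 ≤ n →
    Compatible A ν (shiftSigma A n) ∧
    ∀ w : List ℕ, w.length = n →
      (ν[Set.indicator (cyl A w) (fun _ => (1 : ℝ))|shiftSigma A n])
        =ᵐ[ν] fun x => dlrNum A φ w x / dlrDen A φ n x

/-- `ν` is non-singular: `ν ∘ σ⁻¹ ∼ ν`. -/
def NonSingular (A : ℕ → ℕ → Bool) (ν : Measure (Space A)) : Prop :=
  ν.map shift ≪ ν ∧ ν ≪ ν.map shift

/-- Conservative non-singular measure. -/
def Conservative (A : ℕ → ℕ → Bool) (ν : Measure (Space A)) : Prop :=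
  NonSingular A ν ∧
    ∀ W : Set (Space A), MeasurableSet W →
      (∀ i j : ℕ, i ≠ j → ν ((shift^[i] ⁻¹' W) ∩ (shift^[j] ⁻¹' W)) = 0) → ν W = 0

/-- The `n`-th variation `Var_n φ`, valued in `ℝ≥0∞`. -/
noncomputable def varn (A : ℕ → ℕ → Bool) (φ : Space A → ℝ) (n : ℕ) : ℝ≥0∞ :=
  ⨆ (x : Space A) (y : Space A) (_ : ∀ i, i < n → x.1 i = y.1 i),
    ENNReal.ofReal |φ x - φ y|

noncomputable def waltersBound (A : ℕ → ℕ → Bool) (φ : Space A → ℝ) (k : ℕ) : ℝ≥0∞ :=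
  ⨆ (n : ℕ) (_ : 1 ≤ n), varn A (birkhoff φ n) (n + k)

/-- The Walters condition. -/
def Walters (A : ℕ → ℕ → Bool) (φ : Space A → ℝ) : Prop :=
  (∀ k, 1 ≤ k → waltersBound A φ k ≠ ⊤) ∧
  Tendsto (waltersBound A φ) atTop (nhds 0)

/-- `φ` is weakly Hölder continuous. -/
def WeaklyHolder (A : ℕ → ℕ → Bool) (φ : Space A → ℝ) : Prop :=
  ∃ H θ : ℝ, 0 < H ∧ θ ∈ Set.Ioo (0 : ℝ) 1 ∧
    ∀ n : ℕ, 2 ≤ n → varn A φ n ≤ ENNReal.ofReal (H * θ ^ n)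

/-- The partition function `Z_n(φ, a)`, valued in `ℝ≥0∞`. -/
noncomputable def Zn (A : ℕ → ℕ → Bool) (φ : Space A → ℝ) (n a : ℕ) : ℝ≥0∞ :=
  ∑' x : {x : Space A // shift^[n] x = x ∧ x.1 0 = a},
    ENNReal.ofReal (Real.exp (birkhoff φ n x.1))

/-- The partition function `Z*_n(φ, a)` over periodic points whose first return to `[a]` is `n`. -/
noncomputable def Znstar (A : ℕ → ℕ → Bool) (φ : Space A → ℝ) (n a : ℕ) : ℝ≥0∞ :=
  ∑' x : {x : Space A // shift^[n] x = x ∧ x.1 0 = a ∧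
      ∀ k, 0 < k → k < n → (shift^[k] x).1 0 ≠ a},
    ENNReal.ofReal (Real.exp (birkhoff φ n x.1))

/-- `P` is the (finite) Gurevich pressure of `φ`. -/
def HasGurevich (A : ℕ → ℕ → Bool) (φ : Space A → ℝ) (P : ℝ) : Prop :=
  ∀ a : ℕ, (cyl A [a]).Nonempty →
    (∀ n, 1 ≤ n → Zn A φ n a ≠ ⊤) ∧
    Tendsto (fun n : ℕ => Real.log (Zn A φ n a).toReal / n) atTop (nhds P)

/-- `φ` is recurrent (with Gurevich pressure `P`). -/
def Recurrent (A : ℕ → ℕ → Bool) (φ : Space A → ℝ) (P : ℝ) : Prop :=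
  ∀ a : ℕ, (cyl A [a]).Nonempty →
    ∑' n : ℕ, ENNReal.ofReal (Real.exp (-((n + 1 : ℕ) : ℝ) * P)) * Zn A φ (n + 1) a = ⊤

/-- `φ` is positive recurrent (with Gurevich pressure `P`). -/
def PosRecurrent (A : ℕ → ℕ → Bool) (φ : Space A → ℝ) (P : ℝ) : Prop :=
  Recurrent A φ P ∧
  ∀ a : ℕ, (cyl A [a]).Nonempty →
    ∑' n : ℕ, ((n + 1 : ℕ) : ℝ≥0∞) *
      ENNReal.ofReal (Real.exp (-((n + 1 : ℕ) : ℝ) * P)) * Znstar A φ (n + 1) a ≠ ⊤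

/-- `φ` is transient (with Gurevich pressure `P`). -/
def Transient (A : ℕ → ℕ → Bool) (φ : Space A → ℝ) (P : ℝ) : Prop :=
  ∀ a : ℕ, (cyl A [a]).Nonempty →
    ∑' n : ℕ, ENNReal.ofReal (Real.exp (-((n + 1 : ℕ) : ℝ) * P)) * Zn A φ (n + 1) a ≠ ⊤

/-- `Σ_A` is topologically mixing. -/
def TopMixing (A : ℕ → ℕ → Bool) : Prop :=
  ∀ a b : ℕ, ∃ N : ℕ, ∀ n, N < n → ∃ x : Space A, x.1 0 = a ∧ (shift^[n] x).1 0 = b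

/-- The big images and preimages (BIP) property. -/
def BIP (A : ℕ → ℕ → Bool) : Prop :=
  ∃ (N : ℕ) (b : Fin N → ℕ), ∀ a : ℕ,
    (∃ i, A (b i) a = true) ∧ (∃ j, A a (b j) = true)

/-- An admissible word. -/
def AdmWord (A : ℕ → ℕ → Bool) (w : List ℕ) : Prop :=
  ∀ (i : ℕ) (h : i + 1 < w.length),
    A (w.get ⟨i, Nat.lt_of_succ_lt h⟩) (w.get ⟨i + 1, h⟩) = true

/-- The image of `E ⊆ [a̲]` under the cylinder-swapping map `v_{a̲,b̲}`. -/
def swapImage (A : ℕ → ℕ → Bool) (b : List ℕ) (E : Set (Space A)) : Set (Space A) :=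
  {y | ∃ x ∈ E, y.1 = concatSeq b ((shift^[b.length] x).1)}

/-- The image of `E` under the prepending map `I_b`. -/
def prepImage (A : ℕ → ℕ → Bool) (b : ℕ) (E : Set (Space A)) : Set (Space A) :=
  {y | ∃ x ∈ E, y.1 = prependSeq b x.1}

/-- The transition matrix of the renewal shift:
`A(1,1) = A(1,i) = A(i,i-1) = 1` (for `i > 1`), all other entries `0`. -/
def renA : ℕ → ℕ → Bool := fun i j => decide ((i = 1 ∧ 1 ≤ j) ∨ (2 ≤ i ∧ j = i - 1))

/-- The transition matrix of the shift `Σ_{𝓡⁻}`: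
`A(i,i+1) = A(i,1) = 1` for `i ≥ 1`, all other entries `0`. -/
def rminusA : ℕ → ℕ → Bool := fun i j => decide (1 ≤ i ∧ (j = i + 1 ∨ j = 1))

/-- The periodic sequence obtained by repeating the word `w`. -/
def perSeq (w : List ℕ) : ℕ → ℕ := fun i => w.getD (i % w.length) 0

/-- The word `(j, j-1, …, 1, n, n-1, …, j+1)`. -/
def gammaWord (j n : ℕ) : List ℕ :=
  ((List.range j).map (· + 1)).reverse ++ ((List.range (n - j)).map (· + (j + 1))).reverse

/-- The point `x̄ = (1, 2, 3, …)` of `Σ_{𝓡⁻}`. -/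
def xbar : Space rminusA := ⟨fun i => i + 1, by intro i; simp [rminusA]⟩



section DLR

variable {A : ℕ → ℕ → Bool}

lemma shift_iterate_apply (n : ℕ) (x : Space A) (i : ℕ) : (shift^[n] x).1 i = x.1 (i + n) := by
  induction n generalizing x with
  | zero => rfl
  | succ n ih => rw [Function.iterate_succ_apply, ih]; rfl

lemma concatSeq_of_lt {w : List ℕ} {u : ℕ → ℕ} {i : ℕ} (h : i < w.length) :
    concatSeq w u i = w[i] := by
  simp [concatSeq, h]

lemma concatSeq_of_le {w : List ℕ} {u : ℕ → ℕ} {i : ℕ} (h : w.length ≤ i) :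
    concatSeq w u i = u (i - w.length) := by
  simp [concatSeq, Nat.not_lt.mpr h]

lemma mem_cyl_iff {w : List ℕ} {x : Space A} :
    x ∈ cyl A w ↔ ∀ i (h : i < w.length), x.1 i = w[i] :=
  ⟨fun hx i h => hx ⟨i, h⟩, fun hx i => hx i.1 i.2⟩

lemma concatSeq_shift_of_mem_cyl {w : List ℕ} {x : Space A} (hx : x ∈ cyl A w) :
    concatSeq w (shift^[w.length] x).1 = x.1 := by
  funext i
  rcases lt_or_ge i w.length with h | h
  · rw [concatSeq_of_lt h, mem_cyl_iff.1 hx i h]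
  · rw [concatSeq_of_le h, shift_iterate_apply, Nat.sub_add_cancel h]

lemma mem_cyl_of_eq_concatSeq {w : List ℕ} {x : Space A} {u : ℕ → ℕ}
    (hx : x.1 = concatSeq w u) : x ∈ cyl A w :=
  mem_cyl_iff.2 fun i h => by rw [hx, concatSeq_of_lt h]

lemma shift_of_eq_concatSeq {w : List ℕ} {x z : Space A}
    (hx : x.1 = concatSeq w z.1) : shift^[w.length] x = z := by
  apply Subtype.ext
  funext i
  rw [shift_iterate_apply, hx, concatSeq_of_le (Nat.le_add_left _ _), Nat.add_sub_cancel]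

lemma concatSeq_concat_tail (w : List ℕ) (u : ℕ → ℕ) :
    concatSeq (w ++ [u 0]) (fun i => u (i + 1)) = concatSeq w u := by
  funext i
  rcases lt_trichotomy i w.length with h | h | h
  · rw [concatSeq_of_lt h, concatSeq_of_lt (by simp; omega), List.getElem_append_left h]
  · subst h
    rw [concatSeq_of_le le_rfl, concatSeq_of_lt (by simp)]
    simp
  · rw [concatSeq_of_le h.le, concatSeq_of_le (by simp; omega)]
    congr 1
    simp
    omega

lemma admWord_of_mem_cyl {w : List ℕ} {x : Space A} (hx : x ∈ cyl A w) : AdmWord A w := by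
  intro i h
  have := x.2 i
  rwa [mem_cyl_iff.1 hx i (by omega), mem_cyl_iff.1 hx (i + 1) h] at this

open Classical in
/-- The point `w z` when it is admissible, and `z` otherwise. -/
noncomputable def prefixPt (w : List ℕ) (z : Space A) : Space A :=
  if h : IsAdm A (concatSeq w z.1) then ⟨concatSeq w z.1, h⟩ else z

open Classical in
/-- The weight `e^{φ_n(w z)} 1{w z ∈ Σ_A}` as a function of the tail `z`. -/
noncomputable def weight (φ : Space A → ℝ) (w : List ℕ) (z : Space A) : ℝ≥0∞ :=
  if IsAdm A (concatSeq w z.1) then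
    ENNReal.ofReal (Real.exp (birkhoff φ w.length (prefixPt w z))) else 0

lemma prefixPt_val {w : List ℕ} {z : Space A} (h : IsAdm A (concatSeq w z.1)) :
    (prefixPt w z).1 = concatSeq w z.1 := by
  simp [prefixPt, h]

lemma ofReal_dlrNum (φ : Space A → ℝ) (w : List ℕ) (x : Space A) :
    ENNReal.ofReal (dlrNum A φ w x) = weight φ w (shift^[w.length] x) := by
  unfold dlrNum weight
  split_ifs with h
  · simp only [prefixPt, h, dif_pos]
  · simp

lemma dlrNum_nonneg (φ : Space A → ℝ) (w : List ℕ) (x : Space A) : 0 ≤ dlrNum A φ w x := by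
  unfold dlrNum
  split_ifs <;> positivity

lemma dlrNum_eq_toReal (φ : Space A → ℝ) (w : List ℕ) (x : Space A) :
    dlrNum A φ w x = (weight φ w (shift^[w.length] x)).toReal := by
  rw [← ofReal_dlrNum, ENNReal.toReal_ofReal (dlrNum_nonneg φ w x)]

lemma weight_ne_top (φ : Space A → ℝ) (w : List ℕ) (z : Space A) : weight φ w z ≠ ⊤ := by
  unfold weight
  split_ifs <;> simp

lemma weight_ne_zero_iff (φ : Space A → ℝ) (w : List ℕ) (z : Space A) :
    weight φ w z ≠ 0 ↔ IsAdm A (concatSeq w z.1) := by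
  unfold weight
  split_ifs with h <;> simp [h, Real.exp_pos]

lemma weight_shift_ne_zero (φ : Space A → ℝ) {w : List ℕ} {x : Space A} (hx : x ∈ cyl A w) :
    weight φ w (shift^[w.length] x) ≠ 0 := by
  rw [weight_ne_zero_iff, concatSeq_shift_of_mem_cyl hx]
  exact x.2

lemma measurable_apply (i : ℕ) : Measurable fun x : Space A => x.1 i :=
  (measurable_pi_apply i).comp measurable_subtype_coe

lemma measurable_shift : Measurable (shift : Space A → Space A) :=
  (measurable_pi_lambda _ fun i => measurable_apply (i + 1)).subtype_mk

lemma measurable_shift_iterate (n : ℕ) : Measurable (shift^[n] : Space A → Space A) :=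
  measurable_shift.iterate n

lemma measurable_concatSeq (w : List ℕ) :
    Measurable fun z : Space A => concatSeq w z.1 := by
  refine measurable_pi_lambda _ fun i => ?_
  rcases lt_or_ge i w.length with h | h
  · simp only [concatSeq_of_lt h, measurable_const]
  · simp only [concatSeq_of_le h]
    exact measurable_apply _

lemma measurableSet_isAdm_concatSeq (w : List ℕ) :
    MeasurableSet {z : Space A | IsAdm A (concatSeq w z.1)} := by
  simp only [IsAdm, Set.ofPred_forall]
  refine MeasurableSet.iInter fun i => ?_
  have hm : Measurable fun z : Space A => (concatSeq w z.1 i, concatSeq w z.1 (i + 1)) :=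
    ((measurable_pi_apply i).comp (measurable_concatSeq w)).prodMk
      ((measurable_pi_apply (i + 1)).comp (measurable_concatSeq w))
  exact hm (MeasurableSet.of_discrete (s := {p : ℕ × ℕ | A p.1 p.2 = true}))

lemma measurable_prefixPt (w : List ℕ) : Measurable (prefixPt w : Space A → Space A) := by
  classical
  have : (fun z : Space A => (prefixPt w z).1) =
      fun z => if IsAdm A (concatSeq w z.1) then concatSeq w z.1 else z.1 := by
    funext z
    unfold prefixPt
    split_ifs <;> rfl
  have hm : Measurable fun z : Space A => (prefixPt w z).1 :=
    this ▸ Measurable.ite (measurableSet_isAdm_concatSeq w) (measurable_concatSeq w)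
      measurable_subtype_coe
  exact hm.subtype_mk (h := fun z => (prefixPt w z).2)

lemma measurable_birkhoff {φ : Space A → ℝ} (hφ : Measurable φ) (n : ℕ) :
    Measurable (birkhoff φ n) :=
  Finset.measurable_fun_sum _ fun i _ => hφ.comp (measurable_shift_iterate i)

lemma measurable_weight {φ : Space A → ℝ} (hφ : Measurable φ) (w : List ℕ) :
    Measurable (weight φ w) := by
  classical
  exact Measurable.ite (measurableSet_isAdm_concatSeq w)
    ((Real.measurable_exp.comp
      ((measurable_birkhoff hφ _).comp (measurable_prefixPt w))).ennreal_ofReal)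
    measurable_const

lemma measurable_inv_weight {φ : Space A → ℝ} (hφ : Measurable φ) (w : List ℕ) :
    Measurable fun z => (weight φ w z)⁻¹ :=
  (measurable_weight hφ w).inv

lemma measurableSet_cyl (w : List ℕ) : MeasurableSet (cyl A w) := by
  simp only [cyl, Set.ofPred_forall]
  exact MeasurableSet.iInter fun i => measurable_apply _ (measurableSet_singleton _)

/-- The total weight of the preimages of `z` under `σ^n`. -/
noncomputable def totalWeight (φ : Space A → ℝ) (n : ℕ) (z : Space A) : ℝ≥0∞ :=
  ∑' w : {w : List ℕ // w.length = n}, weight φ w.1 z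

lemma measurable_totalWeight {φ : Space A → ℝ} (hφ : Measurable φ) (n : ℕ) :
    Measurable (totalWeight φ n) :=
  Measurable.tsum fun w => measurable_weight hφ w.1

/-- The first `n` symbols of `x`. -/
def initWord (n : ℕ) (x : Space A) : List ℕ := (List.range n).map x.1

lemma length_initWord (n : ℕ) (x : Space A) : (initWord n x).length = n := by simp [initWord]

lemma mem_cyl_initWord (n : ℕ) (x : Space A) : x ∈ cyl A (initWord n x) :=
  mem_cyl_iff.2 fun i h => by simp [initWord]

lemma eq_initWord_of_mem_cyl {w : List ℕ} {x : Space A} (hx : x ∈ cyl A w) :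
    w = initWord w.length x :=
  List.ext_getElem (length_initWord _ _).symm fun i h _ => by
    simp [initWord, mem_cyl_iff.1 hx i h]

lemma dlrDen_eq_toReal (φ : Space A → ℝ) (n : ℕ) (x : Space A) :
    dlrDen A φ n x = (totalWeight φ n (shift^[n] x)).toReal := by
  have hsum := ENNReal.tsum_toReal_eq
    (f := fun w : {w : List ℕ // w.length = n} => weight φ w.1 (shift^[n] x))
    fun w => weight_ne_top φ w.1 _
  rw [totalWeight, hsum, dlrDen]
  let g : {y : Space A // shift^[n] y = shift^[n] x} → {w : List ℕ // w.length = n} :=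
    fun y => ⟨initWord n y.1, length_initWord n y.1⟩
  have hcat (y : {y : Space A // shift^[n] y = shift^[n] x}) :
      concatSeq (initWord n y.1) (shift^[n] x).1 = y.1.1 := by
    have := concatSeq_shift_of_mem_cyl (mem_cyl_initWord n y.1)
    rwa [length_initWord, y.2] at this
  have hg : Function.Injective g := fun y y' h => by
    have h' : initWord n y.1 = initWord n y'.1 := congrArg Subtype.val h
    apply Subtype.ext
    apply Subtype.ext
    rw [← hcat y, ← hcat y', h']
  rw [← hg.tsum_eq]
  · refine tsum_congr fun y => ?_
    have hadm : IsAdm A (concatSeq (initWord n y.1) (shift^[n] x).1) := by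
      rw [hcat y]
      exact y.1.2
    have hpt : prefixPt (initWord n y.1) (shift^[n] x) = y.1 :=
      Subtype.ext ((prefixPt_val hadm).trans (hcat y))
    simp only [g, weight, if_pos hadm, hpt, length_initWord]
    rw [ENNReal.toReal_ofReal (Real.exp_pos _).le]
  · intro w hw
    have hadm : IsAdm A (concatSeq w.1 (shift^[n] x).1) := by
      rw [← weight_ne_zero_iff φ]
      intro h0
      simp [h0] at hw
    have hpt := prefixPt_val hadm
    refine ⟨⟨prefixPt w.1 (shift^[n] x), ?_⟩, Subtype.ext ?_⟩
    · have := shift_of_eq_concatSeq hpt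
      rwa [w.2] at this
    · have := eq_initWord_of_mem_cyl (mem_cyl_of_eq_concatSeq hpt)
      rw [w.2] at this
      exact this.symm

/-- The image under `σ^{|w|}` of the restriction of `ν` to the cylinder `[w]`. -/
noncomputable def tailMeasure (ν : Measure (Space A)) (w : List ℕ) : Measure (Space A) :=
  (ν.restrict (cyl A w)).map shift^[w.length]

lemma tailMeasure_apply (ν : Measure (Space A)) (w : List ℕ) {s : Set (Space A)}
    (hs : MeasurableSet s) :
    tailMeasure ν w s = ν (cyl A w ∩ shift^[w.length] ⁻¹' s) := by
  rw [tailMeasure, Measure.map_apply (measurable_shift_iterate _) hs,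
    Measure.restrict_apply (measurable_shift_iterate _ hs), Set.inter_comm]

lemma weight_ne_zero_ae {φ : Space A → ℝ} (hφ : Measurable φ) (ν : Measure (Space A))
    (w : List ℕ) : ∀ᵐ z ∂tailMeasure ν w, weight φ w z ≠ 0 := by
  exact (ae_map_iff (measurable_shift_iterate _).aemeasurable
    (measurable_weight hφ w (measurableSet_singleton 0).compl)).2 <|
    ae_restrict_of_forall_mem (measurableSet_cyl w) fun x hx => weight_shift_ne_zero φ hx

lemma sum_tailMeasure (ν : Measure (Space A)) (n : ℕ) :
    Measure.sum (fun w : {w : List ℕ // w.length = n} => tailMeasure ν w.1) =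
      ν.map shift^[n] := by
  have hU : (⋃ w : {w : List ℕ // w.length = n}, cyl A w.1) = Set.univ :=
    Set.eq_univ_of_forall fun x =>
      Set.mem_iUnion.2 ⟨⟨initWord n x, length_initWord n x⟩, mem_cyl_initWord n x⟩
  have hd : Pairwise (Function.onFun Disjoint
      fun w : {w : List ℕ // w.length = n} => cyl A w.1) := by
    intro v w hvw
    refine Set.disjoint_left.2 fun x hv hw => hvw (Subtype.ext ?_)
    rw [eq_initWord_of_mem_cyl hv, eq_initWord_of_mem_cyl hw, v.2, w.2]
  have h := Measure.restrict_iUnion (μ := ν) hd fun w => measurableSet_cyl w.1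
  rw [hU, Measure.restrict_univ] at h
  conv_rhs => rw [h]
  rw [Measure.map_sum (measurable_shift_iterate n).aemeasurable]
  congr 1
  funext w
  rw [tailMeasure, w.2]

lemma iUnion_symbol : (⋃ s : ℕ, {z : Space A | z.1 0 = s}) = Set.univ :=
  Set.eq_univ_of_forall fun x => Set.mem_iUnion.2 ⟨x.1 0, rfl⟩

lemma measurableSet_symbol (i s : ℕ) : MeasurableSet {z : Space A | z.1 i = s} :=
  measurable_apply i (measurableSet_singleton s)

lemma shift_preimage_symbol (n s : ℕ) :
    shift^[n] ⁻¹' {z : Space A | z.1 0 = s} = {x : Space A | x.1 n = s} := by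
  ext x
  simp [shift_iterate_apply]

/-- The normalising factor `1 / Σ_{y : σ^n y = z} e^{φ_n(y)}`, with value `0` if the sum diverges. -/
noncomputable def normFactor (φ : Space A → ℝ) (n : ℕ) (z : Space A) : ℝ≥0∞ :=
  ENNReal.ofReal (totalWeight φ n z).toReal⁻¹

lemma measurable_normFactor {φ : Space A → ℝ} (hφ : Measurable φ) (n : ℕ) :
    Measurable (normFactor φ n) :=
  (measurable_totalWeight hφ n).ennreal_toReal.inv.ennreal_ofReal

lemma ofReal_dlrNum_div_dlrDen (φ : Space A → ℝ) (w : List ℕ) (x : Space A) :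
    ENNReal.ofReal (dlrNum A φ w x / dlrDen A φ w.length x) =
      (weight φ w * normFactor φ w.length) (shift^[w.length] x) := by
  rw [div_eq_mul_inv, ENNReal.ofReal_mul (dlrNum_nonneg φ w x), ofReal_dlrNum, dlrDen_eq_toReal,
    Pi.mul_apply, normFactor]

lemma dlr_ratio_nonneg (φ : Space A → ℝ) (w : List ℕ) (n : ℕ) (x : Space A) :
    0 ≤ dlrNum A φ w x / dlrDen A φ n x := by
  rw [dlrDen_eq_toReal]
  exact div_nonneg (dlrNum_nonneg φ w x) ENNReal.toReal_nonneg

lemma shiftSigma_le (n : ℕ) : shiftSigma A n ≤ Subtype.instMeasurableSpace :=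
  (measurable_shift_iterate n).comap_le

lemma compatible_shiftSigma {ν : Measure (Space A)}
    (hfin : ∀ n s : ℕ, ν {x : Space A | x.1 n = s} ≠ ⊤) (n : ℕ) :
    Compatible A ν (shiftSigma A n) := by
  refine ⟨fun s => {x | x.1 n = s}, fun s => ?_, fun s => hfin n s,
    Set.eq_univ_of_forall fun x => Set.mem_iUnion.2 ⟨x.1 n, rfl⟩⟩
  exact ⟨_, measurableSet_symbol 0 s, shift_preimage_symbol n s⟩

lemma Compatible.sigmaFinite_trim {ν : Measure (Space A)} {m : MeasurableSpace (Space A)}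
    (hc : Compatible A ν m) (hm : m ≤ Subtype.instMeasurableSpace) : SigmaFinite (ν.trim hm) := by
  obtain ⟨s, hs, hfin, hU⟩ := hc
  refine ⟨⟨⟨s, fun _ => trivial, fun k => ?_, hU⟩⟩⟩
  rw [trim_measurableSet_eq hm (hs k)]
  exact (hfin k).lt_top

lemma measure_cyl_ne_top {ν : Measure (Space A)}
    (hfin : ∀ n s : ℕ, ν {x : Space A | x.1 n = s} ≠ ⊤) {w : List ℕ} (hw : 1 ≤ w.length) :
    ν (cyl A w) ≠ ⊤ :=
  measure_ne_top_of_subset (fun _ hx => mem_cyl_iff.1 hx 0 hw) (hfin 0 w[0])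

lemma integrable_indicator_cyl {ν : Measure (Space A)}
    (hfin : ∀ n s : ℕ, ν {x : Space A | x.1 n = s} ≠ ⊤) {w : List ℕ} (hw : 1 ≤ w.length) :
    Integrable (Set.indicator (cyl A w) fun _ => (1 : ℝ)) ν :=
  (integrable_indicator_iff (measurableSet_cyl w)).2
    (integrableOn_const (measure_cyl_ne_top hfin hw))

lemma setIntegral_indicator_cyl (ν : Measure (Space A)) (w : List ℕ) (T : Set (Space A)) :
    ∫ x in T, Set.indicator (cyl A w) (fun _ => (1 : ℝ)) x ∂ν = (ν (cyl A w ∩ T)).toReal := by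
  rw [setIntegral_indicator (measurableSet_cyl w), setIntegral_const, Set.inter_comm]
  simp [Measure.real]

lemma setLIntegral_dlr_ratio {φ : Space A → ℝ} (hφ : Measurable φ) (ν : Measure (Space A))
    (w : List ℕ) {E : Set (Space A)} (hE : MeasurableSet E) :
    ((ν.map shift^[w.length]).withDensity (weight φ w * normFactor φ w.length)) E =
      ∫⁻ x in shift^[w.length] ⁻¹' E,
        ENNReal.ofReal (dlrNum A φ w x / dlrDen A φ w.length x) ∂ν := by
  rw [withDensity_apply _ hE, setLIntegral_map hE
    ((measurable_weight hφ w).mul (measurable_normFactor hφ _)) (measurable_shift_iterate _)]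
  simp only [ofReal_dlrNum_div_dlrDen]

lemma tailMeasure_eq_of_condExp {φ : Space A → ℝ} (hφ : Measurable φ) {ν : Measure (Space A)}
    (hfin : ∀ n s : ℕ, ν {x : Space A | x.1 n = s} ≠ ⊤) {w : List ℕ} (hw : 1 ≤ w.length)
    (h : ν[Set.indicator (cyl A w) (fun _ => (1 : ℝ))|shiftSigma A w.length]
      =ᵐ[ν] fun x => dlrNum A φ w x / dlrDen A φ w.length x) :
    tailMeasure ν w =
      (ν.map shift^[w.length]).withDensity (weight φ w * normFactor φ w.length) := by
  have hm := shiftSigma_le (A := A) w.length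
  have := (compatible_shiftSigma hfin w.length).sigmaFinite_trim hm
  refine (Measure.ext_iff_of_iUnion_eq_univ iUnion_symbol).2 fun s => ?_
  ext E hE
  have hE' := hE.inter (measurableSet_symbol (A := A) 0 s)
  rw [Measure.restrict_apply hE, Measure.restrict_apply hE, tailMeasure_apply ν w hE',
    setLIntegral_dlr_ratio hφ ν w hE']
  set T := shift^[w.length] ⁻¹' (E ∩ {z : Space A | z.1 0 = s})
  have hTm : MeasurableSet[shiftSigma A w.length] T := ⟨_, hE', rfl⟩
  have hint : Integrable (fun x => dlrNum A φ w x / dlrDen A φ w.length x) ν :=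
    integrable_condExp.congr h
  rw [← ofReal_integral_eq_lintegral_ofReal hint.integrableOn
      (Eventually.of_forall fun x => dlr_ratio_nonneg φ w _ x),
    ← integral_congr_ae (ae_restrict_of_ae h),
    setIntegral_condExp hm (integrable_indicator_cyl hfin hw) hTm, setIntegral_indicator_cyl,
    ENNReal.ofReal_toReal
      (measure_ne_top_of_subset Set.inter_subset_left (measure_cyl_ne_top hfin hw))]

lemma condExp_eq_of_tailMeasure_eq {φ : Space A → ℝ} (hφ : Measurable φ) {ν : Measure (Space A)}
    (hfin : ∀ n s : ℕ, ν {x : Space A | x.1 n = s} ≠ ⊤) {w : List ℕ} (hw : 1 ≤ w.length)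
    (h : tailMeasure ν w =
      (ν.map shift^[w.length]).withDensity (weight φ w * normFactor φ w.length)) :
    ν[Set.indicator (cyl A w) (fun _ => (1 : ℝ))|shiftSigma A w.length]
      =ᵐ[ν] fun x => dlrNum A φ w x / dlrDen A φ w.length x := by
  have hm := shiftSigma_le (A := A) w.length
  have := (compatible_shiftSigma hfin w.length).sigmaFinite_trim hm
  have hmeas : Measurable[shiftSigma A w.length]
      fun x : Space A => dlrNum A φ w x / dlrDen A φ w.length x := by
    simp only [dlrNum_eq_toReal, dlrDen_eq_toReal]
    exact ((measurable_weight hφ w).ennreal_toReal.div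
      (measurable_totalWeight hφ w.length).ennreal_toReal).comp (comap_measurable _)
  have hlint (T : Set (Space A)) (hT : MeasurableSet[shiftSigma A w.length] T) :
      ∫⁻ x in T, ENNReal.ofReal (dlrNum A φ w x / dlrDen A φ w.length x) ∂ν =
        ν (cyl A w ∩ T) := by
    obtain ⟨E, hE, rfl⟩ := hT
    rw [← setLIntegral_dlr_ratio hφ ν w hE, ← h, tailMeasure_apply ν w hE]
  have hnn (T : Set (Space A)) :
      0 ≤ᵐ[ν.restrict T] fun x => dlrNum A φ w x / dlrDen A φ w.length x :=
    Eventually.of_forall fun x => dlr_ratio_nonneg φ w _ x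
  have hasm (T : Set (Space A)) : AEStronglyMeasurable
      (fun x => dlrNum A φ w x / dlrDen A φ w.length x) (ν.restrict T) :=
    (hmeas.mono hm le_rfl).aestronglyMeasurable
  refine (ae_eq_condExp_of_forall_setIntegral_eq hm (integrable_indicator_cyl hfin hw)
    (fun T hT _ => ?_) (fun T hT _ => ?_) hmeas.stronglyMeasurable.aestronglyMeasurable).symm
  · refine (lintegral_ofReal_ne_top_iff_integrable (hasm T) (hnn T)).1 ?_
    rw [hlint T hT]
    exact measure_ne_top_of_subset Set.inter_subset_left (measure_cyl_ne_top hfin hw)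
  · rw [setIntegral_indicator_cyl, integral_eq_lintegral_of_nonneg_ae (hnn T) (hasm T), hlint T hT]

/-- The exchange relation between cylinders of length `n`: a symmetric form of the DLR
equations that does not involve the normalising sum. -/
def Exchange (φ : Space A → ℝ) (ν : Measure (Space A)) (n : ℕ) : Prop :=
  ∀ v w : List ℕ, v.length = n → w.length = n →
    (tailMeasure ν v).withDensity (weight φ w) = (tailMeasure ν w).withDensity (weight φ v)

lemma Exchange.setLIntegral_eq {φ : Space A → ℝ} (hφ : Measurable φ) {ν : Measure (Space A)}
    {n : ℕ} (h : Exchange φ ν n) {v w : List ℕ} (hv : v.length = n) (hw : w.length = n)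
    {g : Space A → ℝ≥0∞} (hg : Measurable g) {E : Set (Space A)} (hE : MeasurableSet E) :
    ∫⁻ z in E, weight φ w z * g z ∂tailMeasure ν v =
      ∫⁻ z in E, weight φ v z * g z ∂tailMeasure ν w := by
  have key (a b : List ℕ) : ∫⁻ z in E, weight φ a z * g z ∂tailMeasure ν b =
      ∫⁻ z in E, g z ∂(tailMeasure ν b).withDensity (weight φ a) := by
    rw [restrict_withDensity hE,
      lintegral_withDensity_eq_lintegral_mul _ (measurable_weight hφ a) hg]
    rfl
  rw [key, key, h v w hv hw]

lemma exchange_of_tailMeasure_eq {φ : Space A → ℝ} (hφ : Measurable φ) {ν : Measure (Space A)}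
    {n : ℕ} (h : ∀ w : List ℕ, w.length = n → tailMeasure ν w =
      (ν.map shift^[n]).withDensity (weight φ w * normFactor φ n)) : Exchange φ ν n := by
  intro v w hv hw
  have hm (a : List ℕ) : Measurable (weight φ a * normFactor φ n) :=
    (measurable_weight hφ a).mul (measurable_normFactor hφ n)
  rw [h v hv, h w hw, ← withDensity_mul _ (hm v) (measurable_weight hφ w),
    ← withDensity_mul _ (hm w) (measurable_weight hφ v)]
  congr 1
  ring

lemma Exchange.totalWeight_ne_top_ae {φ : Space A → ℝ} (hφ : Measurable φ) {ν : Measure (Space A)}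
    (hfin : ∀ n s : ℕ, ν {x : Space A | x.1 n = s} ≠ ⊤) {n : ℕ} (h : Exchange φ ν n)
    {w : List ℕ} (hw : w.length = n) : ∀ᵐ z ∂tailMeasure ν w, totalWeight φ n z ≠ ⊤ := by
  rw [← Measure.restrict_univ (μ := tailMeasure ν w), ← iUnion_symbol, ae_restrict_iUnion_iff]
  intro s
  have hs := measurableSet_symbol (A := A) 0 s
  have hinv := measurable_inv_weight hφ w
  have hle : ∫⁻ z in {z : Space A | z.1 0 = s}, totalWeight φ n z * (weight φ w z)⁻¹
      ∂tailMeasure ν w ≤ (ν.map shift^[n]) {z : Space A | z.1 0 = s} := by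
    have hexp (z : Space A) : totalWeight φ n z * (weight φ w z)⁻¹ =
        ∑' v : {v : List ℕ // v.length = n}, weight φ v.1 z * (weight φ w z)⁻¹ :=
      ENNReal.tsum_mul_right.symm
    have hm (v : {v : List ℕ // v.length = n}) :
        Measurable fun z => weight φ v.1 z * (weight φ w z)⁻¹ :=
      (measurable_weight hφ v.1).mul hinv
    rw [lintegral_congr hexp, lintegral_tsum fun v => (hm v).aemeasurable,
      ← sum_tailMeasure, Measure.sum_apply _ hs]
    refine ENNReal.tsum_le_tsum fun v => ?_
    rw [← h.setLIntegral_eq hφ v.2 hw hinv hs, ← setLIntegral_one]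
    exact lintegral_mono fun z => ENNReal.mul_inv_le_one _
  rw [Measure.map_apply (measurable_shift_iterate n) hs, shift_preimage_symbol] at hle
  filter_upwards [ae_lt_top ((measurable_totalWeight hφ n).mul hinv)
    (ne_top_of_le_ne_top (hfin n s) hle)] with z hz htop
  simp [htop, ENNReal.top_mul, weight_ne_top] at hz

lemma Exchange.tailMeasure_eq {φ : Space A → ℝ} (hφ : Measurable φ) {ν : Measure (Space A)}
    (hfin : ∀ n s : ℕ, ν {x : Space A | x.1 n = s} ≠ ⊤) {n : ℕ} (h : Exchange φ ν n)
    {w : List ℕ} (hw : w.length = n) : tailMeasure ν w =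
      (ν.map shift^[n]).withDensity (weight φ w * normFactor φ n) := by
  ext E hE
  have hnorm : ∀ᵐ z ∂tailMeasure ν w, totalWeight φ n z * normFactor φ n z = 1 := by
    filter_upwards [h.totalWeight_ne_top_ae hφ hfin hw, weight_ne_zero_ae hφ ν w] with z hz hz0
    have hpos : totalWeight φ n z ≠ 0 := fun h0 =>
      hz0 (ENNReal.tsum_eq_zero.1 h0 ⟨w, hw⟩)
    rw [normFactor, ENNReal.ofReal_inv_of_pos (ENNReal.toReal_pos hpos hz),
      ENNReal.ofReal_toReal hz, ENNReal.mul_inv_cancel hpos hz]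
  rw [withDensity_apply _ hE, ← sum_tailMeasure, Measure.restrict_sum _ hE, lintegral_sum_measure]
  simp only [Pi.mul_apply]
  simp_rw [fun v : {w : List ℕ // w.length = n} =>
    h.setLIntegral_eq hφ v.2 hw (measurable_normFactor hφ n) hE]
  have hm (v : {v : List ℕ // v.length = n}) :
      Measurable fun z => weight φ v.1 z * normFactor φ n z :=
    (measurable_weight hφ v.1).mul (measurable_normFactor hφ n)
  rw [← lintegral_tsum fun v => (hm v).aemeasurable]
  simp_rw [ENNReal.tsum_mul_right]
  rw [← setLIntegral_one]
  exact lintegral_congr_ae (ae_restrict_of_ae (hnorm.mono fun z hz => hz.symm))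

theorem isDLR_iff_exchange {φ : Space A → ℝ} (hφ : Measurable φ) {ν : Measure (Space A)}
    (hfin : ∀ n s : ℕ, ν {x : Space A | x.1 n = s} ≠ ⊤) :
    IsDLR A φ ν ↔ ∀ n, 1 ≤ n → Exchange φ ν n := by
  constructor
  · intro h n hn
    refine exchange_of_tailMeasure_eq hφ ?_
    rintro w rfl
    exact tailMeasure_eq_of_condExp hφ hfin hn ((h _ hn).2 w rfl)
  · intro h n hn
    refine ⟨compatible_shiftSigma hfin n, ?_⟩
    rintro w rfl
    exact condExp_eq_of_tailMeasure_eq hφ hfin hn ((h _ hn).tailMeasure_eq hφ hfin rfl)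

lemma concatSeq_concat_shift {w : List ℕ} {s : ℕ} {x : Space A} (hx : x.1 w.length = s) :
    concatSeq (w ++ [s]) (shift^[(w ++ [s]).length] x).1 =
      concatSeq w (shift^[w.length] x).1 := by
  rw [← concatSeq_concat_tail w]
  congr 1
  · rw [shift_iterate_apply, Nat.zero_add, hx]
  · funext i
    rw [shift_iterate_apply, shift_iterate_apply]
    have : i + (w ++ [s]).length = i + 1 + w.length := by
      simp
      omega
    rw [this]

lemma mem_cyl_concat_iff {w : List ℕ} {s : ℕ} {x : Space A} :
    x ∈ cyl A (w ++ [s]) ↔ x ∈ cyl A w ∧ x.1 w.length = s := by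
  simp only [mem_cyl_iff]
  refine ⟨fun h => ⟨fun i hi => ?_, ?_⟩, fun h i hi => ?_⟩
  · rw [h i (by simp; omega), List.getElem_append_left hi]
  · rw [h w.length (by simp)]
    simp
  · rcases lt_or_ge i w.length with hlt | hge
    · rw [List.getElem_append_left hlt, h.1 i hlt]
    · obtain rfl : i = w.length := by
        simp at hi
        omega
      simp [h.2]

lemma isAdm_concatSeq_iff (w : List ℕ) (z : Space A) :
    IsAdm A (concatSeq w z.1) ↔ AdmWord A (w ++ [z.1 0]) := by
  constructor
  · intro h
    have hpt := prefixPt_val h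
    refine admWord_of_mem_cyl (mem_cyl_concat_iff.2 ⟨mem_cyl_of_eq_concatSeq hpt, ?_⟩)
    rw [hpt, concatSeq_of_le le_rfl, Nat.sub_self]
  · intro h i
    rcases lt_or_ge i w.length with hi | hi
    · have hA := h i (by simp; omega)
      rw [← concatSeq_concat_tail w, concatSeq_of_lt (by simp; omega),
        concatSeq_of_lt (by simp; omega)]
      exact hA
    · rw [concatSeq_of_le hi, concatSeq_of_le (by omega), Nat.sub_add_comm hi]
      exact z.2 _

lemma dlrNum_concat (φ : Space A → ℝ) {w : List ℕ} {s : ℕ} {x : Space A}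
    (hx : x.1 w.length = s) :
    dlrNum A φ (w ++ [s]) x = dlrNum A φ w x * Real.exp (φ (shift^[w.length] x)) := by
  have hc := concatSeq_concat_shift hx
  by_cases h : IsAdm A (concatSeq w (shift^[w.length] x).1)
  · have h' : IsAdm A (concatSeq (w ++ [s]) (shift^[(w ++ [s]).length] x).1) := hc ▸ h
    have hpt : (⟨_, h'⟩ : Space A) = ⟨_, h⟩ := Subtype.ext hc
    have hs : shift^[w.length] (⟨_, h⟩ : Space A) = shift^[w.length] x :=
      shift_of_eq_concatSeq rfl
    rw [dlrNum, dlrNum, dif_pos h, dif_pos h', hpt, ← Real.exp_add, List.length_append,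
      List.length_singleton, birkhoff, Finset.sum_range_succ, hs]
    rfl
  · rw [dlrNum, dlrNum, dif_neg h, dif_neg (hc ▸ h), zero_mul]

lemma swapImage_concat {w : List ℕ} {s : ℕ} {E : Set (Space A)}
    (hE : ∀ x ∈ E, x.1 w.length = s) : swapImage A (w ++ [s]) E = swapImage A w E := by
  ext y
  refine exists_congr fun x => and_congr_right fun hx => ?_
  rw [concatSeq_concat_shift (hE x hx)]

lemma swapImage_cyl_inter {a b : List ℕ} (hab : a.length = b.length) {F : Set (Space A)}
    (hF : ∀ z ∈ F, IsAdm A (concatSeq a z.1)) :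
    swapImage A b (cyl A a ∩ shift^[a.length] ⁻¹' F) = cyl A b ∩ shift^[b.length] ⁻¹' F := by
  ext y
  constructor
  · rintro ⟨x, ⟨-, hxF⟩, hy⟩
    refine ⟨mem_cyl_of_eq_concatSeq hy, ?_⟩
    rw [Set.mem_preimage, shift_of_eq_concatSeq hy, ← hab]
    exact hxF
  · rintro ⟨hyb, hyF⟩
    have hpt := prefixPt_val (hF _ hyF)
    have hs := shift_of_eq_concatSeq hpt
    refine ⟨prefixPt a (shift^[b.length] y), ⟨mem_cyl_of_eq_concatSeq hpt, ?_⟩, ?_⟩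
    · rwa [Set.mem_preimage, hs]
    · rw [hab] at hs
      rw [hs, concatSeq_shift_of_mem_cyl hyb]

lemma setLIntegral_dlrNum_div {φ : Space A → ℝ} (hφ : Measurable φ) (ν : Measure (Space A))
    {a b : List ℕ} (hab : a.length = b.length) {F : Set (Space A)} (hF : MeasurableSet F) :
    ∫⁻ x in cyl A a ∩ shift^[a.length] ⁻¹' F,
        ENNReal.ofReal (dlrNum A φ b x / dlrNum A φ a x) ∂ν =
      ∫⁻ z in F, weight φ b z * (weight φ a z)⁻¹ ∂tailMeasure ν a := by
  have hS := measurable_shift_iterate (A := A) a.length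
  have hm : Measurable fun z => weight φ b z * (weight φ a z)⁻¹ :=
    (measurable_weight hφ b).mul (measurable_inv_weight hφ a)
  rw [tailMeasure, setLIntegral_map hF hm hS, Measure.restrict_restrict (hS hF), Set.inter_comm]
  refine setLIntegral_congr_fun ((hS hF).inter (measurableSet_cyl a)) fun x hx => ?_
  have hne := weight_shift_ne_zero φ hx.2
  rw [← ofReal_dlrNum] at hne
  rw [ENNReal.ofReal_div_of_pos (by simpa using hne), ofReal_dlrNum, ofReal_dlrNum, ← hab,
    ENNReal.div_eq_inv_mul, mul_comm]

lemma weight_mul_inv_cancel {φ : Space A → ℝ} {a : List ℕ} {z : Space A}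
    (h : weight φ a z ≠ 0) : weight φ a z * (weight φ a z)⁻¹ = 1 :=
  ENNReal.mul_inv_cancel h (weight_ne_top φ a z)

lemma Exchange.measure_swapImage {φ : Space A → ℝ} (hφ : Measurable φ) {ν : Measure (Space A)}
    {n : ℕ} (h : Exchange φ ν n) {a b : List ℕ} (ha : a.length = n) (hb : b.length = n)
    {E : Set (Space A)} (hEa : E ⊆ cyl A a) (hE : MeasurableSet E) :
    ν (swapImage A b E) = ∫⁻ x in E, ENNReal.ofReal (dlrNum A φ b x / dlrNum A φ a x) ∂ν := by
  set F : Set (Space A) := {z | IsAdm A (concatSeq a z.1)} ∩ prefixPt a ⁻¹' E with hFdef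
  have hF : MeasurableSet F :=
    (measurableSet_isAdm_concatSeq a).inter (measurable_prefixPt a hE)
  have hab : a.length = b.length := ha.trans hb.symm
  have hEF : E = cyl A a ∩ shift^[a.length] ⁻¹' F := by
    have hmem {x : Space A} (hx : x ∈ cyl A a) : shift^[a.length] x ∈ F ↔ x ∈ E := by
      have hadm : IsAdm A (concatSeq a (shift^[a.length] x).1) := by
        rw [concatSeq_shift_of_mem_cyl hx]
        exact x.2
      have hpt : prefixPt a (shift^[a.length] x) = x :=
        Subtype.ext ((prefixPt_val hadm).trans (concatSeq_shift_of_mem_cyl hx))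
      rw [hFdef, Set.mem_inter_iff, Set.mem_preimage, hpt]
      exact and_iff_right hadm
    ext x
    exact ⟨fun hx => ⟨hEa hx, (hmem (hEa hx)).2 hx⟩, fun hx => (hmem hx.1).1 hx.2⟩
  rw [hEF, swapImage_cyl_inter hab fun z hz => hz.1, setLIntegral_dlrNum_div hφ ν hab hF,
    h.setLIntegral_eq hφ ha hb (measurable_inv_weight hφ a) hF, ← tailMeasure_apply ν b hF,
    ← setLIntegral_one]
  exact setLIntegral_congr_fun hF fun z hz =>
    (weight_mul_inv_cancel ((weight_ne_zero_iff φ a z).2 hz.1)).symm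

lemma admWord_of_tailMeasure_ne_zero {ν : Measure (Space A)} {v : List ℕ} {s : ℕ}
    (h : tailMeasure ν v {z | z.1 0 = s} ≠ 0) :
    AdmWord A (v ++ [s]) ∧ 0 < ν (cyl A (v ++ [s])) := by
  have hcyl : cyl A v ∩ shift^[v.length] ⁻¹' {z : Space A | z.1 0 = s} = cyl A (v ++ [s]) := by
    rw [shift_preimage_symbol]
    ext x
    exact mem_cyl_concat_iff.symm
  rw [tailMeasure_apply ν v (measurableSet_symbol 0 s), hcyl] at h
  obtain ⟨x, hx⟩ := nonempty_of_measure_ne_zero h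
  exact ⟨admWord_of_mem_cyl hx, pos_iff_ne_zero.2 h⟩

lemma exchange_on_symbol {φ : Space A → ℝ} (hφ : Measurable φ) {ν : Measure (Space A)}
    {v w : List ℕ} (hvw : v.length = w.length) {s : ℕ}
    (hswap : AdmWord A (v ++ [s]) → AdmWord A (w ++ [s]) → 0 < ν (cyl A (v ++ [s])) →
      ∀ E ⊆ cyl A (v ++ [s]), MeasurableSet E → ν (swapImage A (w ++ [s]) E) =
        ∫⁻ x in E, ENNReal.ofReal (dlrNum A φ (w ++ [s]) x / dlrNum A φ (v ++ [s]) x) ∂ν)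
    (hv : tailMeasure ν v {z | z.1 0 = s} ≠ 0) :
    ((tailMeasure ν v).restrict {z | z.1 0 = s}).withDensity (weight φ w) =
      ((tailMeasure ν w).restrict {z | z.1 0 = s}).withDensity (weight φ v) := by
  set X : Set (Space A) := {z | z.1 0 = s} with hX
  have hXm : MeasurableSet X := measurableSet_symbol 0 s
  obtain ⟨hvadm, hpos⟩ := admWord_of_tailMeasure_ne_zero hv
  by_cases hwadm : AdmWord A (w ++ [s])
  · have hdens : (tailMeasure ν w).restrict X = ((tailMeasure ν v).restrict X).withDensity
        (weight φ w * fun z => (weight φ v z)⁻¹) := by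
      ext E hE
      have hEX := hE.inter hXm
      have hsym {x : Space A} (hx : x ∈ cyl A v ∩ shift^[v.length] ⁻¹' (E ∩ X)) :
          x.1 v.length = s := by
        have : (shift^[v.length] x).1 0 = s := hx.2.2
        rwa [shift_iterate_apply, Nat.zero_add] at this
      have hsub : cyl A v ∩ shift^[v.length] ⁻¹' (E ∩ X) ⊆ cyl A (v ++ [s]) :=
        fun x hx => mem_cyl_concat_iff.2 ⟨hx.1, hsym hx⟩
      have hmeas : MeasurableSet (cyl A v ∩ shift^[v.length] ⁻¹' (E ∩ X)) :=
        (measurableSet_cyl v).inter (measurable_shift_iterate _ hEX)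
      have key := hswap hvadm hwadm hpos _ hsub hmeas
      have hadm : ∀ z ∈ E ∩ X, IsAdm A (concatSeq v z.1) := fun z hz => by
        rw [isAdm_concatSeq_iff, hz.2]
        exact hvadm
      have hratio : ∀ x ∈ cyl A v ∩ shift^[v.length] ⁻¹' (E ∩ X),
          ENNReal.ofReal (dlrNum A φ (w ++ [s]) x / dlrNum A φ (v ++ [s]) x) =
            ENNReal.ofReal (dlrNum A φ w x / dlrNum A φ v x) := fun x hx => by
        rw [dlrNum_concat φ (hsym hx), dlrNum_concat φ (hvw ▸ hsym hx), hvw,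
          mul_div_mul_right _ _ (Real.exp_ne_zero _)]
      rw [swapImage_concat fun x hx => hvw ▸ hsym hx, swapImage_cyl_inter hvw hadm,
        ← tailMeasure_apply ν w hEX, setLIntegral_congr_fun hmeas hratio,
        setLIntegral_dlrNum_div hφ ν hvw hEX] at key
      rw [Measure.restrict_apply hE, key, withDensity_apply _ hE, Measure.restrict_restrict hE]
      rfl
    rw [hdens, ← withDensity_mul _ ((measurable_weight hφ w).mul (measurable_inv_weight hφ v))
      (measurable_weight hφ v)]
    refine withDensity_congr_ae ?_
    filter_upwards [ae_restrict_of_ae (weight_ne_zero_ae hφ ν v)] with z hz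
    rw [Pi.mul_apply, Pi.mul_apply, mul_assoc, mul_comm (weight φ v z)⁻¹,
      weight_mul_inv_cancel hz, mul_one]
  · have hw0 : tailMeasure ν w X = 0 := by
      by_contra h
      exact hwadm (admWord_of_tailMeasure_ne_zero h).1
    rw [Measure.restrict_eq_zero.2 hw0, withDensity_zero_left, ← withDensity_zero]
    refine withDensity_congr_ae (ae_restrict_of_forall_mem hXm fun z hz => ?_)
    by_contra h
    have := (isAdm_concatSeq_iff w z).1 ((weight_ne_zero_iff φ w z).1 h)
    rw [show z.1 0 = s from hz] at this
    exact hwadm this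

lemma exchange_of_measure_swapImage {φ : Space A → ℝ} (hφ : Measurable φ) {ν : Measure (Space A)}
    {n : ℕ}
    (hswap : ∀ (v w : List ℕ) (s : ℕ), v.length = n → w.length = n → AdmWord A (v ++ [s]) →
      AdmWord A (w ++ [s]) → 0 < ν (cyl A (v ++ [s])) →
      ∀ E ⊆ cyl A (v ++ [s]), MeasurableSet E → ν (swapImage A (w ++ [s]) E) =
        ∫⁻ x in E, ENNReal.ofReal (dlrNum A φ (w ++ [s]) x / dlrNum A φ (v ++ [s]) x) ∂ν) :
    Exchange φ ν n := by
  intro v w hv hw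
  refine (Measure.ext_iff_of_iUnion_eq_univ iUnion_symbol).2 fun s => ?_
  have hXm := measurableSet_symbol (A := A) 0 s
  rw [restrict_withDensity hXm, restrict_withDensity hXm]
  by_cases hv0 : tailMeasure ν v {z | z.1 0 = s} = 0
  · by_cases hw0 : tailMeasure ν w {z | z.1 0 = s} = 0
    · rw [Measure.restrict_eq_zero.2 hv0, Measure.restrict_eq_zero.2 hw0, withDensity_zero_left,
        withDensity_zero_left]
    · exact (exchange_on_symbol hφ (hw.trans hv.symm) (hswap w v s hw hv) hw0).symm
  · exact exchange_on_symbol hφ (hv.trans hw.symm) (hswap v w s hv hw) hv0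

end DLR

theorem statement4 (A : ℕ → ℕ → Bool) (hA : NoDegenerate A)
    (φ : Space A → ℝ) (hφ : Measurable φ)
    (ν : Measure (Space A)) (hsf : SigmaFinite ν)
    (hfin : ∀ n s : ℕ, ν {x : Space A | x.1 n = s} ≠ ⊤) :
    IsDLR A φ ν ↔
      ∀ a b : List ℕ, 1 ≤ a.length → a.length = b.length →
        AdmWord A a → AdmWord A b → a.getLast? = b.getLast? →
        0 < ν (cyl A a) →
        ∀ E ⊆ cyl A a, MeasurableSet E →
          ν (swapImage A b E)
            = ∫⁻ x in E, ENNReal.ofReal (dlrNum A φ b x / dlrNum A φ a x) ∂ν := by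
  rw [isDLR_iff_exchange hφ hfin]
  constructor
  · intro h a b ha hab _ _ _ _ E hEa hE
    exact (h a.length ha).measure_swapImage hφ rfl hab.symm hEa hE
  · intro h n _
    refine exchange_of_measure_swapImage hφ fun v w s hv hw hva hwa hpos => ?_
    exact h (v ++ [s]) (w ++ [s]) (by simp) (by simp [hv, hw]) hva hwa (by simp) hpos

end CMS
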